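/- Suppose Assumptions A1–A3 hold and let π be the probability kernel from F^ℕ to E such that π_{ξ_{-1}} is the ℙ-a.s. total-variation limit of δ_z P_{X_{-n}} ⋯ P_{X_{-1}} as n → ∞, where ξ_{-1} = (X_{-1-j})_{j≥0}. Then ∫_E V dπ_{ξ_{-1}} < ∞ ℙ-almost surely. -/

import Mathlib

open MeasureTheory ProbabilityTheory Filter
open scoped ENNReal

noncomputable section

/-- The shift operator on two-sided paths. -/
def zshift {α : Type*} (x : ℤ → α) : ℤ → α := fun t => x (t + 1)

/-- One step of the inhomogeneous chain: the pushforward of `μ` by the kernel `P_x`. -/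
def stepMeas {E F : Type*} [MeasurableSpace E] [MeasurableSpace F]
    (P : Kernel (F × E) E) (x : F) (μ : Measure E) : Measure E :=
  μ.bind fun y => P (x, y)

/-- `iterFrom P [x₁, …, xₙ] μ = μ P_{x₁} ⋯ P_{xₙ}`: the law at the final time of the
inhomogeneous chain with initial law `μ` run through the kernels `P_{x₁}, …, P_{xₙ}`. -/
def iterFrom {E F : Type*} [MeasurableSpace E] [MeasurableSpace F]
    (P : Kernel (F × E) E) : List F → Measure E → Measure E
  | [], μ => μ
  | x :: xs, μ => iterFrom P xs (stepMeas P x μ)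

/-- The total variation distance between two measures. -/
def dTV {E : Type*} [MeasurableSpace E] (μ ν : Measure E) : ℝ≥0∞ :=
  ⨆ (A : Set E) (_ : MeasurableSet A), max (μ A - ν A) (ν A - μ A)

/-- Garsia's running maximum. -/
def garsiaMax {α : Type*} (T : α → α) (g : α → ℝ) : ℕ → α → ℝ
  | 0 => fun _ => 0
  | n + 1 => fun x => max 0 (g x + garsiaMax T g n (T x))

lemma garsiaMax_nonneg {α : Type*} (T : α → α) (g : α → ℝ) (n : ℕ) (x : α) :
    0 ≤ garsiaMax T g n x := by
  cases n with
  | zero => exact le_rfl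
  | succ n => exact le_max_left _ _

lemma garsiaMax_mono {α : Type*} (T : α → α) (g : α → ℝ) (n : ℕ) :
    ∀ x, garsiaMax T g n x ≤ garsiaMax T g (n + 1) x := by
  induction n with
  | zero => intro x; exact garsiaMax_nonneg T g 1 x
  | succ n ih =>
    intro x
    have := ih (T x)
    show max 0 (g x + garsiaMax T g n (T x)) ≤ max 0 (g x + garsiaMax T g (n + 1) (T x))
    gcongr

lemma sum_le_garsiaMax {α : Type*} (T : α → α) (g : α → ℝ) (n : ℕ) :
    ∀ x, ∑ i ∈ Finset.range n, g (T^[i] x) ≤ garsiaMax T g n x := by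
  induction n with
  | zero => intro x; simp [garsiaMax]
  | succ n ih =>
    intro x
    rw [Finset.sum_range_succ']
    have := ih (T x)
    show _ ≤ max 0 (g x + garsiaMax T g n (T x))
    refine le_trans ?_ (le_max_right _ _)
    simp only [Function.iterate_succ_apply, Function.iterate_zero, id]
    linarith

lemma garsiaMax_measurable {α : Type*} [MeasurableSpace α] (T : α → α) (hT : Measurable T)
    (g : α → ℝ) (hg : Measurable g) (n : ℕ) : Measurable (garsiaMax T g n) := by
  induction n with
  | zero => exact measurable_const
  | succ n ih => exact measurable_const.max (hg.add (ih.comp hT))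

lemma garsiaMax_integrable {α : Type*} [MeasurableSpace α] (μ : Measure α)
    (T : α → α) (hT : MeasurePreserving T μ μ)
    (g : α → ℝ) (hg : Integrable g μ) (n : ℕ) : Integrable (garsiaMax T g n) μ := by
  induction n with
  | zero => exact integrable_zero _ _ _
  | succ n ih =>
    exact (integrable_zero _ _ _).sup (hg.add (hT.integrable_comp_of_integrable ih))

lemma garsia_ineq {α : Type*} [MeasurableSpace α] (μ : Measure α)
    (T : α → α) (hT : MeasurePreserving T μ μ)
    (g : α → ℝ) (hgm : Measurable g) (hg : Integrable g μ) (n : ℕ) :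
    0 ≤ ∫ x in {x | 0 < garsiaMax T g (n + 1) x}, g x ∂μ := by
  set M := garsiaMax T g (n + 1) with hM
  have hMi : Integrable M μ := garsiaMax_integrable μ T hT g hg _
  have hMm : Measurable M := garsiaMax_measurable T hT.measurable g hgm _
  have hMT : Integrable (fun x => M (T x)) μ := hT.integrable_comp_of_integrable hMi
  have hD : MeasurableSet {x | 0 < M x} := measurableSet_lt measurable_const hMm
  have h1 : ∫ x in {x | 0 < M x}, (M x - M (T x)) ∂μ ≤ ∫ x in {x | 0 < M x}, g x ∂μ := by
    refine setIntegral_mono_on (hMi.sub hMT).integrableOn hg.integrableOn hD ?_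
    intro x hx
    have hx' : 0 < max 0 (g x + garsiaMax T g n (T x)) := hx
    have h2 : M x = g x + garsiaMax T g n (T x) := by
      show max 0 (g x + garsiaMax T g n (T x)) = _
      rcases lt_max_iff.1 hx' with h | h
      · exact absurd h (lt_irrefl _)
      · exact max_eq_right h.le
    have h3 := garsiaMax_mono T g n (T x)
    rw [← hM] at h3
    linarith
  refine le_trans ?_ h1
  rw [integral_sub hMi.integrableOn hMT.integrableOn]
  have h4 : ∫ x in {x | 0 < M x}, M x ∂μ = ∫ x, M x ∂μ := by
    refine setIntegral_eq_integral_of_forall_compl_eq_zero ?_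
    intro x hx
    exact le_antisymm (not_lt.1 hx) (garsiaMax_nonneg T g _ x)
  have h5 : ∫ x in {x | 0 < M x}, M (T x) ∂μ ≤ ∫ x, M (T x) ∂μ :=
    setIntegral_le_integral hMT (Eventually.of_forall fun x => garsiaMax_nonneg T g _ (T x))
  have h6 : ∫ x, M (T x) ∂μ = ∫ x, M x ∂μ := by
    have h := integral_map (μ := μ) hT.measurable.aemeasurable (f := M)
      hMm.aestronglyMeasurable
    rw [hT.map_eq] at h
    exact h.symm
  linarith

lemma ergodic_bdd {α : Type*} [MeasurableSpace α] (μ : Measure α) [IsProbabilityMeasure μ]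
    (T : α → α) (hT : MeasurePreserving T μ μ)
    (f : α → ℝ) (hfm : Measurable f) (hf : Integrable f μ) (h0 : ∀ x, 0 ≤ f x) :
    ∀ᵐ x ∂μ, ∃ C : ℝ, ∀ n : ℕ, ∑ i ∈ Finset.range n, f (T^[i] x) ≤ C * n := by
  have key : ∀ a : ℕ, μ (⋃ n : ℕ, {x | 0 < garsiaMax T (fun x => f x - (a + 1)) (n + 1) x})
      ≤ ENNReal.ofReal ((∫ x, f x ∂μ) / (a + 1)) := by
    intro a
    rw [Monotone.measure_iUnion]
    · refine iSup_le fun n => ?_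
      set D := {x | 0 < garsiaMax T (fun x => f x - ((a : ℝ) + 1)) (n + 1) x} with hD
      have hgm : Measurable (fun x => f x - ((a : ℝ) + 1)) := hfm.sub_const _
      have hg : Integrable (fun x => f x - ((a : ℝ) + 1)) μ := hf.sub (integrable_const _)
      have h := garsia_ineq μ T hT _ hgm hg n
      rw [integral_sub hf.integrableOn (integrable_const _).integrableOn] at h
      rw [setIntegral_const] at h
      have h2 : ∫ x in D, f x ∂μ ≤ ∫ x, f x ∂μ :=
        setIntegral_le_integral hf (Eventually.of_forall h0)
      rw [← ofReal_measureReal]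
      apply ENNReal.ofReal_le_ofReal
      rw [le_div_iff₀ (by positivity)]
      simp only [smul_eq_mul] at h
      linarith
    · refine monotone_nat_of_le_succ fun n x hx => ?_
      exact lt_of_lt_of_le hx (garsiaMax_mono T _ (n + 1) x)
  rw [ae_iff]
  refine le_antisymm ?_ zero_le
  have hlim : Tendsto (fun a : ℕ => ENNReal.ofReal ((∫ x, f x ∂μ) / ((a : ℝ) + 1))) atTop
      (nhds 0) := by
    rw [← ENNReal.ofReal_zero]
    apply ENNReal.tendsto_ofReal
    exact tendsto_const_nhds.div_atTop
      (tendsto_atTop_add_const_right _ _ tendsto_natCast_atTop_atTop)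
  refine ge_of_tendsto' hlim fun a => le_trans (measure_mono ?_) (key a)
  intro x hx
  simp only [Set.mem_ofPred_eq, not_exists, not_forall, not_le] at hx
  obtain ⟨n, hn⟩ := hx ((a : ℝ) + 1)
  rw [Set.mem_iUnion]
  refine ⟨n, ?_⟩
  have h1 := sum_le_garsiaMax T (fun x => f x - ((a : ℝ) + 1)) n x
  have h2 := garsiaMax_mono T (fun x => f x - ((a : ℝ) + 1)) n x
  rw [Finset.sum_sub_distrib] at h1
  simp only [Finset.sum_const, Finset.card_range, nsmul_eq_mul] at h1
  rw [Set.mem_ofPred_eq]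
  linarith

lemma iter_bound {E F : Type*} [MeasurableSpace E] [MeasurableSpace F]
    (P : Kernel (F × E) E) [IsMarkovKernel P] (W : E → ℝ≥0∞) (hW : Measurable W) (lam b : F → ℝ≥0∞)
    (hdrift : ∀ (x : F) (y : E), ∫⁻ z, W z ∂(P (x, y)) ≤ lam x * W y + b x)
    (xs : ℕ → F) (n : ℕ) : ∀ μ : Measure E, μ Set.univ ≤ 1 →
    ∫⁻ z, W z ∂(iterFrom P ((List.range n).reverse.map xs) μ) ≤
      (∏ i ∈ Finset.range n, lam (xs i)) * ∫⁻ z, W z ∂μ +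
      ∑ k ∈ Finset.range n, (∏ i ∈ Finset.range k, lam (xs i)) * b (xs k) := by
  induction n with
  | zero => intro μ _; simp [iterFrom]
  | succ n ih =>
    intro μ hμ
    have e : (List.range (n + 1)).reverse.map xs = xs n :: (List.range n).reverse.map xs := by
      simp [List.range_succ]
    rw [e]
    show ∫⁻ z, W z ∂(iterFrom P ((List.range n).reverse.map xs) (stepMeas P (xs n) μ)) ≤ _
    have hs : stepMeas P (xs n) μ Set.univ ≤ 1 := by
      refine (Measure.bind_apply_le _ MeasurableSet.univ).trans ?_
      simpa using hμ
    have hs2 : ∫⁻ z, W z ∂(stepMeas P (xs n) μ) ≤ lam (xs n) * ∫⁻ z, W z ∂μ + b (xs n) := by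
      refine (Measure.lintegral_bind_le _ _ _).trans ?_
      refine (lintegral_mono fun y => hdrift (xs n) y).trans ?_
      rw [lintegral_add_right _ measurable_const, lintegral_const_mul _ hW, lintegral_const]
      gcongr
      exact mul_le_of_le_one_right' hμ
    refine (ih _ hs).trans ?_
    rw [Finset.prod_range_succ, Finset.sum_range_succ]
    calc _ ≤ (∏ i ∈ Finset.range n, lam (xs i)) * (lam (xs n) * ∫⁻ z, W z ∂μ + b (xs n)) +
      ∑ k ∈ Finset.range n, (∏ i ∈ Finset.range k, lam (xs i)) * b (xs k) := by gcongr
      _ = _ := by ring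

lemma le_add_dTV {E : Type*} [MeasurableSpace E] (μ ν : Measure E) (A : Set E)
    (hA : MeasurableSet A) : ν A ≤ μ A + dTV μ ν := by
  have h : ν A - μ A ≤ dTV μ ν :=
    (le_max_right (μ A - ν A) (ν A - μ A)).trans
      (le_iSup₂ (f := fun (A : Set E) (_ : MeasurableSet A) => max (μ A - ν A) (ν A - μ A)) A hA)
  exact tsub_le_iff_left.1 h

lemma lintegral_le_of_dTV {E : Type*} [MeasurableSpace E] (μ : ℕ → Measure E) (ν : Measure E)
    (V : E → ℝ) (hV : Measurable V) (hV0 : ∀ y, 0 < V y) (C : ℝ≥0∞)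
    (hC : ∀ n, ∫⁻ y, ENNReal.ofReal (V y) ∂(μ n) ≤ C)
    (h : Tendsto (fun n => dTV (μ n) ν) atTop (nhds 0)) :
    ∫⁻ y, ENNReal.ofReal (V y) ∂ν ≤ C := by
  have lc : ∀ m : Measure E, ∫⁻ y, ENNReal.ofReal (V y) ∂m =
      ∫⁻ t in Set.Ioi (0 : ℝ), m {a | t < V a} := fun m =>
    lintegral_eq_lintegral_meas_lt m (Eventually.of_forall fun y => (hV0 y).le) hV.aemeasurable
  rw [lc]
  have hanti : ∀ m : Measure E, Measurable fun t : ℝ => m {a | t < V a} := fun m =>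
    Antitone.measurable fun s t hst => measure_mono fun a ha => lt_of_le_of_lt hst ha
  calc ∫⁻ t in Set.Ioi (0 : ℝ), ν {a | t < V a}
      ≤ ∫⁻ t in Set.Ioi (0 : ℝ), liminf (fun n => μ n {a | t < V a}) atTop := by
        refine lintegral_mono fun t => ?_
        refine ENNReal.le_of_forall_pos_le_add fun ε hε _ => ?_
        rw [← tsub_le_iff_right]
        refine le_liminf_of_le (by isBoundedDefault) ?_
        have hε' : (0 : ℝ≥0∞) < ε := by exact_mod_cast hε
        filter_upwards [h.eventually_lt_const hε'] with n hn
        rw [tsub_le_iff_right]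
        refine (le_add_dTV (μ n) ν _ (measurableSet_lt measurable_const hV)).trans ?_
        gcongr
    _ ≤ liminf (fun n => ∫⁻ t in Set.Ioi (0 : ℝ), μ n {a | t < V a}) atTop :=
        lintegral_liminf_le fun n => hanti _
    _ ≤ C := by
        simp_rw [← lc]
        exact liminf_le_of_le (by isBoundedDefault) fun b hb => by
          obtain ⟨n, hn⟩ := hb.exists
          exact hn.trans (hC n)

lemma prod_rpow_bdd (a : ℕ → ℝ) (ha : ∀ i, 0 ≤ a i) (C : ℝ)
    (hC : ∀ n : ℕ, ∑ i ∈ Finset.range n, Real.log (max (a i) 1) ≤ C * n) :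
    IsBoundedUnder (· ≤ ·) atTop
      (fun n : ℕ => (∏ i ∈ Finset.range n, a i) ^ ((n : ℝ)⁻¹)) := by
  refine ⟨Real.exp C, ?_⟩
  rw [eventually_map]
  filter_upwards [eventually_gt_atTop 0] with n hn
  have hn' : (0 : ℝ) < n := by exact_mod_cast hn
  have h1 : ∏ i ∈ Finset.range n, a i ≤ Real.exp (C * n) := by
    refine le_trans ?_ (Real.exp_le_exp.2 (hC n))
    rw [Real.exp_sum]
    refine Finset.prod_le_prod (fun i _ => ha i) fun i _ => ?_
    rw [Real.exp_log (lt_of_lt_of_le one_pos (le_max_right _ _))]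
    exact le_max_left _ _
  refine (Real.rpow_le_rpow (Finset.prod_nonneg fun i _ => ha i) h1 (by positivity)).trans ?_
  rw [← Real.exp_mul, mul_assoc, mul_inv_cancel₀ hn'.ne', mul_one]

lemma series_bound (a b : ℕ → ℝ) (ha : ∀ i, 0 ≤ a i) (hb : ∀ i, 0 ≤ b i) (v : ℝ≥0∞) (hv : v ≠ ∞)
    (hbd : IsBoundedUnder (· ≤ ·) atTop
      (fun n : ℕ => (∏ i ∈ Finset.range n, a i) ^ ((n : ℝ)⁻¹)))
    (hl : atTop.limsup (fun n : ℕ => (∏ i ∈ Finset.range n, a i) ^ ((n : ℝ)⁻¹)) < 1)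
    (hlog : ∀ m : ℕ, ∀ᶠ n : ℕ in atTop, ((m : ℝ) + 1) * Real.log (max (b n) 1) ≤ n) :
    ∃ C : ℝ≥0∞, C < ∞ ∧ ∀ n : ℕ, (∏ i ∈ Finset.range n, ENNReal.ofReal (a i)) * v +
      ∑ k ∈ Finset.range n, (∏ i ∈ Finset.range k, ENNReal.ofReal (a i)) * ENNReal.ofReal (b k)
      ≤ C := by
  obtain ⟨r, hr, hr1⟩ := exists_between hl
  have hev := eventually_lt_of_limsup_lt hr hbd
  have hp0 : ∀ n, 0 ≤ ∏ i ∈ Finset.range n, a i := fun n => Finset.prod_nonneg fun i _ => ha i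
  have hr0 : 0 < r := by
    obtain ⟨n, hn⟩ := hev.exists
    exact lt_of_le_of_lt (Real.rpow_nonneg (hp0 n) _) hn
  have hp : ∀ᶠ n : ℕ in atTop, ∏ i ∈ Finset.range n, a i ≤ r ^ n := by
    filter_upwards [hev, eventually_gt_atTop 0] with n hn hn0
    calc _ = ((∏ i ∈ Finset.range n, a i) ^ ((n : ℝ)⁻¹)) ^ n :=
          (Real.rpow_inv_natCast_pow (hp0 n) hn0.ne').symm
      _ ≤ r ^ n := pow_le_pow_left₀ (Real.rpow_nonneg (hp0 n) _) hn.le n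
  obtain ⟨m, hm⟩ : ∃ m : ℕ, r * Real.exp (1 / ((m : ℝ) + 1)) < 1 := by
    have : Tendsto (fun m : ℕ => r * Real.exp (1 / ((m : ℝ) + 1))) atTop
        (nhds (r * Real.exp 0)) :=
      (((Real.continuous_exp.tendsto 0).comp tendsto_one_div_add_atTop_nhds_zero_nat)).const_mul r
    rw [Real.exp_zero, mul_one] at this
    exact (this.eventually_lt_const hr1).exists
  set q := r * Real.exp (1 / ((m : ℝ) + 1)) with hq
  have hq0 : 0 ≤ q := by positivity
  have hsum : Summable fun k => (∏ i ∈ Finset.range k, a i) * b k := by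
    refine Summable.of_norm_bounded_eventually_nat (summable_geometric_of_lt_one hq0 hm) ?_
    filter_upwards [hp, hlog m] with n h1 h2
    rw [Real.norm_of_nonneg (mul_nonneg (hp0 n) (hb n)), hq, mul_pow, ← Real.exp_nat_mul]
    refine mul_le_mul h1 ?_ (hb n) (by positivity)
    calc b n ≤ max (b n) 1 := le_max_left _ _
      _ = Real.exp (Real.log (max (b n) 1)) :=
        (Real.exp_log (lt_of_lt_of_le one_pos (le_max_right _ _))).symm
      _ ≤ _ := by
        apply Real.exp_le_exp.2
        rw [mul_one_div, le_div_iff₀ (by positivity)]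
        linarith
  have hpt : Tendsto (fun n => ∏ i ∈ Finset.range n, a i) atTop (nhds 0) :=
    tendsto_of_tendsto_of_tendsto_of_le_of_le' tendsto_const_nhds
      (tendsto_pow_atTop_nhds_zero_of_lt_one hr0.le hr1)
      (Eventually.of_forall hp0) hp
  obtain ⟨K, hK⟩ := hpt.bddAbove_range
  refine ⟨ENNReal.ofReal K * v + ENNReal.ofReal (∑' k, (∏ i ∈ Finset.range k, a i) * b k), ?_, ?_⟩
  · exact ENNReal.add_lt_top.2 ⟨ENNReal.mul_lt_top ENNReal.ofReal_lt_top hv.lt_top,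
      ENNReal.ofReal_lt_top⟩
  · intro n
    have e : ∀ k, ∏ i ∈ Finset.range k, ENNReal.ofReal (a i) =
        ENNReal.ofReal (∏ i ∈ Finset.range k, a i) := fun k =>
      (ENNReal.ofReal_prod_of_nonneg fun i _ => ha i).symm
    simp_rw [e, ← ENNReal.ofReal_mul (hp0 _)]
    rw [← ENNReal.ofReal_sum_of_nonneg fun k _ => mul_nonneg (hp0 k) (hb k)]
    gcongr
    · exact hK (Set.mem_range_self n)
    · exact hsum.sum_le_tsum _ fun k _ => mul_nonneg (hp0 k) (hb k)

lemma log_small {Ω : Type*} [MeasurableSpace Ω] (Pr : Measure Ω) [IsProbabilityMeasure Pr]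
    (Y : Ω → ℝ) (Z : ℕ → Ω → ℝ) (hY : Integrable Y Pr) (hY0 : ∀ ω, 0 ≤ Y ω)
    (hid : ∀ n, ∀ A : Set ℝ, MeasurableSet A → Pr (Z n ⁻¹' A) = Pr (Y ⁻¹' A)) :
    ∀ᵐ ω ∂Pr, ∀ m : ℕ, ∀ᶠ n : ℕ in atTop, ((m : ℝ) + 1) * Z n ω ≤ n := by
  rw [ae_all_iff]
  intro m
  let : MeasureSpace Ω := ⟨Pr⟩
  have h := tsum_prob_mem_Ioi_lt_top (X := fun ω => ((m : ℝ) + 1) * Y ω) (hY.const_mul _)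
    (fun ω => mul_nonneg (by positivity) (hY0 ω))
  have hA : ∀ n : ℕ, MeasurableSet {y : ℝ | (n : ℝ) < ((m : ℝ) + 1) * y} := fun n =>
    measurableSet_lt measurable_const (measurable_const.mul measurable_id)
  have h2 : (∑' n : ℕ, Pr (Z n ⁻¹' {y : ℝ | (n : ℝ) < ((m : ℝ) + 1) * y})) ≠ ∞ := by
    simp_rw [hid _ _ (hA _)]
    exact h.ne
  filter_upwards [ae_eventually_notMem h2] with ω hω
  filter_upwards [hω] with n hn
  exact not_lt.1 hn

theorem random_invariant_measure_integrates_V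
    {E F : Type*}
    [MeasurableSpace E] [TopologicalSpace E] [PolishSpace E] [BorelSpace E]
    [MeasurableSpace F] [TopologicalSpace F] [PolishSpace F] [BorelSpace F]
    {Ω : Type*} [MeasurableSpace Ω] (Pr : Measure Ω) [IsProbabilityMeasure Pr]
    (X : ℤ → Ω → F) (hX : ∀ t, Measurable (X t))
    (P : Kernel (F × E) E) [IsMarkovKernel P]
    -- A1 : the environment is stationary
    (hstat : (Pr.map fun ω => fun t => X t ω).map zshift = Pr.map fun ω => fun t => X t ω)
    -- A2 : drift condition with random coefficients
    (V : E → ℝ) (hVmeas : Measurable V) (hVpos : ∀ y, 0 < V y)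
    (lam b : F → ℝ) (hlam : Measurable lam) (hb : Measurable b)
    (hlam0 : ∀ x, 0 ≤ lam x) (hb0 : ∀ x, 0 ≤ b x)
    (hlamlog : ∫⁻ ω, ENNReal.ofReal (Real.log (max (lam (X 0 ω)) 1)) ∂Pr < ∞)
    (hblog : ∫⁻ ω, ENNReal.ofReal (Real.log (max (b (X 0 ω)) 1)) ∂Pr < ∞)
    (hdrift : ∀ (x : F) (y : E), ∫⁻ z, ENNReal.ofReal (V z) ∂(P (x, y)) ≤
      ENNReal.ofReal (lam x) * ENNReal.ofReal (V y) + ENNReal.ofReal (b x))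
    (hlyap : ∀ᵐ ω ∂Pr, atTop.limsup
      (fun n : ℕ => (∏ i ∈ Finset.range n, lam (X (-(i : ℤ) - 1) ω)) ^ ((n : ℝ)⁻¹)) < 1)
    -- A3 : sublevel sets of V are small sets, uniformly in the environment
    (η : ℝ → F → ℝ) (hηmeas : Measurable fun p : ℝ × F => η p.1 p.2)
    (hη01 : ∀ R > (0 : ℝ), ∀ x, η R x ∈ Set.Ioo (0 : ℝ) 1)
    (hsmall : ∀ R > (0 : ℝ), ∃ ν : Kernel F E, IsMarkovKernel ν ∧
      ∀ (x : F) (y : E) (A : Set E), MeasurableSet A → V y ≤ R →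
        ENNReal.ofReal (η R x) * ν x A ≤ P (x, y) A)
    -- `π` is the probability kernel from `F^ℕ` to `E` whose value at `ξ_t` is the a.s.
    -- total-variation limit of the backward iterations `δ_z P_{X_{t-n}} ⋯ P_{X_t}`
    (π : Kernel (ℕ → F) E) [IsMarkovKernel π]
    (hπ : ∀ (t : ℤ) (z : E), ∀ᵐ ω ∂Pr,
      Tendsto (fun n : ℕ =>
        dTV (iterFrom P ((List.range (n + 1)).map fun i => X (t - (n : ℤ) + (i : ℤ)) ω)
            (Measure.dirac z))
          (π fun j : ℕ => X (t - (j : ℤ)) ω)) atTop (nhds 0)) :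
    -- the random invariant measure integrates the drift function V
    ∀ᵐ ω ∂Pr, ∫⁻ y, ENNReal.ofReal (V y) ∂(π fun j : ℕ => X (-1 - (j : ℤ)) ω) < ∞ := by
  rcases isEmpty_or_nonempty E with hE | ⟨⟨z⟩⟩
  · refine Eventually.of_forall fun ω => ?_
    rw [Measure.eq_zero_of_isEmpty (π fun j : ℕ => X (-1 - (j : ℤ)) ω)]
    simp
  have hXm : Measurable (fun ω => fun t => X t ω) := measurable_pi_lambda _ hX
  set Q : Measure (ℤ → F) := Pr.map fun ω => fun t => X t ω with hQ
  have : IsProbabilityMeasure Q := Measure.isProbabilityMeasure_map hXm.aemeasurable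
  have hzm : Measurable (zshift : (ℤ → F) → ℤ → F) :=
    measurable_pi_lambda _ fun t => measurable_pi_apply (t + 1)
  let S : (ℤ → F) → ℤ → F := fun x t => x (t - 1)
  have hSm : Measurable S := measurable_pi_lambda _ fun t => measurable_pi_apply (t - 1)
  have hSz : S ∘ zshift = id := by
    funext x t
    simp [S, zshift]
  have hS : MeasurePreserving S Q Q := by
    refine ⟨hSm, ?_⟩
    conv_lhs => rw [← hstat]
    rw [Measure.map_map hSm hzm, hSz, Measure.map_id]
  have hSi : ∀ (n : ℕ) (x : ℤ → F) (t : ℤ), S^[n] x t = x (t - n) := by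
    intro n
    induction n with
    | zero => intro x t; simp
    | succ n ih =>
      intro x t
      rw [Function.iterate_succ_apply, ih]
      show x (t - n - 1) = _
      congr 1
      push_cast
      ring
  -- one-dimensional marginals
  have hmarg : ∀ n : ℕ, Pr.map (X (-(n : ℤ))) = Pr.map (X 0) := by
    intro n
    have h1 := (hS.iterate n).map_eq
    have h2 : Pr.map (X (-(n : ℤ))) = (Q.map S^[n]).map (fun x => x 0) := by
      rw [hQ, Measure.map_map (measurable_pi_apply 0) (hSm.iterate n),
        Measure.map_map ((measurable_pi_apply 0).comp (hSm.iterate n)) hXm]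
      congr 1
      funext ω
      simp [hSi]
    rw [h2, h1, hQ, Measure.map_map (measurable_pi_apply 0) hXm]
    rfl
  have hmeasl : ∀ c : F → ℝ, Measurable c → Measurable fun x => Real.log (max (c x) 1) :=
    fun c hc => Real.measurable_log.comp (hc.max measurable_const)
  have hl0 : ∀ c : ℝ, 0 ≤ Real.log (max c 1) := fun c => Real.log_nonneg (le_max_right _ _)
  have hint : ∀ c : F → ℝ, Measurable c →
      ∫⁻ ω, ENNReal.ofReal (Real.log (max (c (X 0 ω)) 1)) ∂Pr < ∞ →
      Integrable (fun ω => Real.log (max (c (X 0 ω)) 1)) Pr := by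
    intro c hc h
    refine ⟨((hmeasl c hc).comp (hX 0)).aestronglyMeasurable, ?_⟩
    rw [hasFiniteIntegral_iff_ofReal (Eventually.of_forall fun ω => hl0 _)]
    exact h
  -- averages of log⁺ λ are bounded
  have hbd : ∀ᵐ ω ∂Pr, ∃ C : ℝ, ∀ n : ℕ,
      ∑ i ∈ Finset.range n, Real.log (max (lam (X (-(i : ℤ) - 1) ω)) 1) ≤ C * n := by
    have hfm : Measurable fun x : ℤ → F => Real.log (max (lam (x (-1))) 1) :=
      (hmeasl lam hlam).comp (measurable_pi_apply (-1))
    have hfi : Integrable (fun x : ℤ → F => Real.log (max (lam (x (-1))) 1)) Q := by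
      rw [hQ, integrable_map_measure hfm.aestronglyMeasurable hXm.aemeasurable]
      have h1 : Integrable (fun x => Real.log (max (lam x) 1)) (Pr.map (X 0)) := by
        rw [integrable_map_measure (hmeasl lam hlam).aestronglyMeasurable (hX 0).aemeasurable]
        exact hint lam hlam hlamlog
      rw [← hmarg 1, integrable_map_measure (hmeasl lam hlam).aestronglyMeasurable
        (hX _).aemeasurable] at h1
      exact h1
    have h := ergodic_bdd Q S hS _ hfm hfi fun x => hl0 _
    filter_upwards [ae_of_ae_map hXm.aemeasurable h] with ω hω
    obtain ⟨C, hC⟩ := hω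
    refine ⟨C, fun n => ?_⟩
    refine le_of_eq_of_le ?_ (hC n)
    refine Finset.sum_congr rfl fun i _ => ?_
    rw [hSi, show (-1 : ℤ) - i = -(i : ℤ) - 1 by ring]
  have hlog := log_small Pr (fun ω => Real.log (max (b (X 0 ω)) 1))
    (fun n ω => Real.log (max (b (X (-(n : ℤ) - 1) ω)) 1)) (hint b hb hblog) (fun ω => hl0 _) (by
      intro n A hA
      have hB : MeasurableSet ((fun x => Real.log (max (b x) 1)) ⁻¹' A) := hmeasl b hb hA
      have h1 := congrArg (fun m => m ((fun x => Real.log (max (b x) 1)) ⁻¹' A)) (hmarg (n + 1))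
      simp only [Measure.map_apply (hX _) hB] at h1
      rw [show -((n + 1 : ℕ) : ℤ) = -(n : ℤ) - 1 by push_cast; ring] at h1
      exact h1)
  filter_upwards [hbd, hlog, hlyap, hπ (-1) z] with ω h1 h2 h3 h4
  obtain ⟨C, hC⟩ := h1
  obtain ⟨K, hK, hKb⟩ := series_bound (fun i => lam (X (-(i : ℤ) - 1) ω))
    (fun i => b (X (-(i : ℤ) - 1) ω)) (fun i => hlam0 _) (fun i => hb0 _)
    (ENNReal.ofReal (V z)) ENNReal.ofReal_ne_top
    (prod_rpow_bdd _ (fun i => hlam0 _) C hC) h3 h2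
  refine lt_of_le_of_lt (lintegral_le_of_dTV _ _ V hVmeas hVpos K ?_ h4) hK
  intro n
  have e : ((List.range (n + 1)).map fun i : ℕ => X (-1 - (n : ℤ) + (i : ℤ)) ω) =
      (List.range (n + 1)).reverse.map fun i : ℕ => X (-(i : ℤ) - 1) ω := by
    apply List.ext_getElem
    · simp
    · intro i hi hi'
      simp only [List.length_map, List.length_range] at hi
      simp only [List.getElem_map, List.getElem_range, List.getElem_reverse, List.length_range]
      congr 1
      omega
  have e0 : ((List.range (n + 1)).map fun i => X (-1 - (n : ℤ) + (i : ℤ)) ω) =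
      ((List.range (n + 1)).map fun i : ℕ => X (-1 - (n : ℤ) + (i : ℤ)) ω) := by
    have e1 : ∀ l : List ℕ, List.flatMap (fun a : ℕ => [(a : ℤ)]) l =
        l.map (fun a : ℕ => (a : ℤ)) := fun l => by
      induction l with
      | nil => rfl
      | cons a l ih => simp [ih]
    simp [List.bind_eq_flatMap, e1]
  rw [e0, e]
  refine (iter_bound P (fun y => ENNReal.ofReal (V y)) hVmeas.ennreal_ofReal
    (fun x => ENNReal.ofReal (lam x)) (fun x => ENNReal.ofReal (b x)) hdrift
    (fun i : ℕ => X (-(i : ℤ) - 1) ω) (n + 1) (Measure.dirac z) (by simp)).trans ?_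
  rw [lintegral_dirac' _ hVmeas.ennreal_ofReal]
  exact hKb (n + 1)


end
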